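/- arXiv:1509.06785 — 2 statements merged into one kernel-verified Lean document; each statement's English description precedes it below -/
import Mathlib

section
/- Let U ⊆ ℝ^m be a convex open set and let G : U → M_m(ℝ) be a smooth matrix-valued function such that G(x) is symmetric for every x ∈ U and such that ∂_k G_{ij} = ∂_j G_{ik} on U for all indices i, j, k. Then there exists a smooth function g : U → ℝ with G_{ij}(x) = ∂²g/∂x^i∂x^j (x) for all x ∈ U and all i, j, i.e. G = Hess(g) on U. -/
open Matrix

/-- Partial derivative of `f` in the `i`-th coordinate direction at `x`. -/
noncomputable def pd {m : ℕ} (i : Fin m) (f : (Fin m → ℝ) → ℝ) (x : Fin m → ℝ) : ℝ :=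
  fderiv ℝ f x (Pi.single i 1)

theorem pd_primitive {m : ℕ} (U : Set (Fin m → ℝ)) (hU : IsOpen U) (hconv : Convex ℝ U)
    (a : Fin m → (Fin m → ℝ) → ℝ)
    (ha : ∀ j, ContDiffOn ℝ (⊤ : ℕ∞) (a j) U)
    (hc : ∀ x ∈ U, ∀ j k, pd k (a j) x = pd j (a k) x) :
    ∃ f : (Fin m → ℝ) → ℝ, ContDiffOn ℝ (⊤ : ℕ∞) f U ∧ ∀ x ∈ U, ∀ j, pd j f x = a j x := by
  let P : Fin m → ((Fin m → ℝ) →L[ℝ] ℝ) := fun j => ContinuousLinearMap.proj j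
  let ω : (Fin m → ℝ) → ((Fin m → ℝ) →L[ℝ] ℝ) := fun x => ∑ j, a j x • P j
  have hω : ContDiffOn ℝ (⊤ : ℕ∞) ω U :=
    ContDiffOn.sum fun j _ => (ha j).smul contDiffOn_const
  have hd : ∀ x ∈ U, HasFDerivAt ω (∑ j, (fderiv ℝ (a j) x).smulRight (P j)) x := by
    intro x hx
    refine HasFDerivAt.fun_sum fun j _ => ?_
    have h1 : DifferentiableAt ℝ (a j) x :=
      ((ha j).differentiableOn (by simp)).differentiableAt (hU.mem_nhds hx)
    exact h1.hasFDerivAt.smul_const (P j)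
  have hexp : ∀ (L : (Fin m → ℝ) →L[ℝ] ℝ) (u : Fin m → ℝ),
      L u = ∑ k, u k * L (Pi.single k 1) := by
    intro L u
    conv_lhs => rw [pi_eq_sum_univ' u]
    simp [map_sum]
  obtain ⟨f, hf⟩ := hconv.exists_forall_hasFDerivAt_of_fderiv_symmetric hU
    (hω.differentiableOn (by simp)) (by
      intro x hx u v
      rw [(hd x hx).fderiv]
      have key : ∀ u v : Fin m → ℝ, (∑ j, (fderiv ℝ (a j) x).smulRight (P j)) u v
          = ∑ j, ∑ k, u k * pd k (a j) x * v j := by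
        intro u v
        simp only [ContinuousLinearMap.sum_apply, ContinuousLinearMap.smulRight_apply,
          ContinuousLinearMap.smul_apply, smul_eq_mul, P, ContinuousLinearMap.proj_apply]
        refine Finset.sum_congr rfl fun j _ => ?_
        rw [hexp (fderiv ℝ (a j) x) u, Finset.sum_mul]
        rfl
      rw [key, key, Finset.sum_comm]
      refine Finset.sum_congr rfl fun j _ => Finset.sum_congr rfl fun k _ => ?_
      rw [hc x hx k j]
      ring)
  refine ⟨f, ?_, ?_⟩
  · refine (contDiffOn_infty_iff_fderiv_of_isOpen hU).2
      ⟨fun x hx => (hf x hx).differentiableAt.differentiableWithinAt, ?_⟩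
    exact hω.congr fun x hx => (hf x hx).fderiv
  · intro x hx j
    simp [pd, (hf x hx).fderiv, ω, P, Pi.single_apply]

/-- A smooth symmetric matrix-valued map on a convex open set satisfying
`∂ₖ G_{ij} = ∂ⱼ G_{ik}` is the Hessian of a smooth function. -/
theorem symmetric_closed_is_hessian {m : ℕ}
    (U : Set (Fin m → ℝ)) (hU : IsOpen U) (hconv : Convex ℝ U)
    (G : (Fin m → ℝ) → Matrix (Fin m) (Fin m) ℝ)
    (hsmooth : ∀ i j : Fin m, ContDiffOn ℝ (⊤ : ℕ∞) (fun x => G x i j) U)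
    (hsymm : ∀ x ∈ U, (G x)ᵀ = G x)
    (hclosed : ∀ x ∈ U, ∀ i j k : Fin m,
      pd k (fun y => G y i j) x = pd j (fun y => G y i k) x) :
    ∃ g : (Fin m → ℝ) → ℝ, ContDiffOn ℝ (⊤ : ℕ∞) g U ∧
      ∀ x ∈ U, ∀ i j : Fin m, G x i j = pd i (fun y => pd j g y) x := by
  have hs : ∀ x ∈ U, ∀ i j, G x i j = G x j i := fun x hx i j =>
    congrFun (congrFun (hsymm x hx) j) i
  choose f hf hpf using fun i : Fin m =>
    pd_primitive U hU hconv (fun j x => G x i j) (hsmooth i) (fun x hx j k => hclosed x hx i j k)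
  obtain ⟨g, hg, hpg⟩ := pd_primitive U hU hconv f hf (fun x hx j k => by
    rw [hpf j x hx k, hpf k x hx j]
    exact hs x hx j k)
  refine ⟨g, hg, fun x hx i j => ?_⟩
  have he : (fun y => pd j g y) =ᶠ[nhds x] f j := by
    filter_upwards [hU.mem_nhds hx] with y hy using hpg y hy j
  have h2 : pd i (fun y => pd j g y) x = pd i (f j) x := by
    unfold pd at he ⊢
    rw [he.fderiv_eq]
  rw [h2, hpf j x hx i]
  exact hs x hx i j
end

section
/- Let U ⊆ ℝ^m be a convex open set and let Ψ : U → M_m(ℝ) be a smooth matrix-valued function satisfying both symmetry conditions ∂_k Ψ_{ij} = ∂_j Ψ_{ik} and ∂_k Ψ_{ji} = ∂_j Ψ_{ki} on U for all indices i, j, k. Then there exist a smooth function τ : U → ℝ and a constant antisymmetric m×m matrix C such that Ψ(x) = Hess(τ)(x) + C for all x ∈ U. If, in addition, vᵀ Ψ(x) v > 0 for every x ∈ U and every nonzero v ∈ ℝ^m, then Hess(τ)(x) is positive definite for every x ∈ U, i.e. τ is strictly convex. -/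
open Matrix

lemma fderiv_eq_sum_pd {m : ℕ} (f : (Fin m → ℝ) → ℝ) (a x : Fin m → ℝ) :
    fderiv ℝ f a x = ∑ k, x k * pd k f a := by
  conv_lhs => rw [← Finset.univ_sum_single x, map_sum]
  refine Finset.sum_congr rfl fun k _ => ?_
  have : (Pi.single k (x k) : Fin m → ℝ) = x k • Pi.single k 1 := by
    rw [← Pi.single_smul]; simp
  rw [this, map_smul]; rfl

lemma poinc {m : ℕ} (U : Set (Fin m → ℝ)) (hU : IsOpen U) (hconv : Convex ℝ U)
    (g : Fin m → (Fin m → ℝ) → ℝ) (hg : ∀ j, ContDiffOn ℝ (⊤ : ℕ∞) (g j) U)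
    (hc : ∀ x ∈ U, ∀ j k, pd k (g j) x = pd j (g k) x) :
    ∃ f : (Fin m → ℝ) → ℝ, ContDiffOn ℝ (⊤ : ℕ∞) f U ∧ ∀ x ∈ U, ∀ j, pd j f x = g j x := by
  let P : Fin m → ((Fin m → ℝ) →L[ℝ] ℝ) := fun j => ContinuousLinearMap.proj j
  let w : (Fin m → ℝ) → ((Fin m → ℝ) →L[ℝ] ℝ) := fun x => ∑ j, g j x • P j
  have hw : ContDiffOn ℝ (⊤ : ℕ∞) w U :=
    ContDiffOn.sum fun j _ => (hg j).smul contDiffOn_const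
  have hgd : ∀ j, ∀ a ∈ U, DifferentiableAt ℝ (g j) a := fun j a ha =>
    ((hg j).contDiffAt (hU.mem_nhds ha)).differentiableAt (by simp)
  have hwd : ∀ a ∈ U, HasFDerivAt w (∑ j, (fderiv ℝ (g j) a).smulRight (P j)) a := fun a ha =>
    HasFDerivAt.fun_sum fun j _ => (hgd j a ha).hasFDerivAt.smul_const (P j)
  obtain ⟨f, hf⟩ := hconv.exists_forall_hasFDerivAt_of_fderiv_symmetric hU
    (fun a ha => (hwd a ha).differentiableAt.differentiableWithinAt) (ω := w) (by
      intro a ha x y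
      rw [(hwd a ha).fderiv]
      simp only [ContinuousLinearMap.sum_apply, ContinuousLinearMap.smulRight_apply,
        ContinuousLinearMap.smul_apply, P, ContinuousLinearMap.proj_apply, smul_eq_mul,
        fderiv_eq_sum_pd, Finset.sum_mul]
      rw [Finset.sum_comm]
      refine Finset.sum_congr rfl fun j _ => Finset.sum_congr rfl fun k _ => ?_
      rw [hc a ha k j]; ring)
  refine ⟨f, ?_, ?_⟩
  · refine (contDiffOn_infty_iff_fderiv_of_isOpen hU).2
      ⟨fun a ha => (hf a ha).differentiableAt.differentiableWithinAt,
        hw.congr fun a ha => (hf a ha).fderiv⟩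
  · intro x hx j
    rw [pd, (hf x hx).fderiv]
    simp [w, P, Pi.single_apply]

lemma pd_congr_open {m : ℕ} {U : Set (Fin m → ℝ)} (hU : IsOpen U) {f g : (Fin m → ℝ) → ℝ}
    (h : ∀ x ∈ U, f x = g x) (x : Fin m → ℝ) (hx : x ∈ U) (i : Fin m) : pd i f x = pd i g x := by
  have : f =ᶠ[nhds x] g := Filter.eventuallyEq_of_mem (hU.mem_nhds hx) h
  rw [pd, pd, this.fderiv_eq]

lemma antisymm_quad {m : ℕ} (C : Matrix (Fin m) (Fin m) ℝ) (hC : Cᵀ = -C) (v : Fin m → ℝ) :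
    v ⬝ᵥ C *ᵥ v = 0 := by
  have h : v ⬝ᵥ C *ᵥ v = v ⬝ᵥ Cᵀ *ᵥ v := by
    rw [Matrix.mulVec_transpose, Matrix.dotProduct_mulVec, dotProduct_comm]
  rw [hC, Matrix.neg_mulVec, dotProduct_neg] at h
  linarith

/-- A smooth matrix-valued map `Ψ` on a convex open set satisfying both symmetry
conditions `∂ₖ Ψ_{ij} = ∂ⱼ Ψ_{ik}` and `∂ₖ Ψ_{ji} = ∂ⱼ Ψ_{ki}` decomposes as
`Ψ = Hess τ + C` for a smooth `τ` and a constant antisymmetric matrix `C`;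
and moreover, if `Ψ` is pointwise positive (taming), then `τ` is strictly convex. -/
theorem psi_decomposes_hessian_plus_antisymmetric {m : ℕ}
    (U : Set (Fin m → ℝ)) (hU : IsOpen U) (hconv : Convex ℝ U)
    (Ψ : (Fin m → ℝ) → Matrix (Fin m) (Fin m) ℝ)
    (hsmooth : ∀ i j : Fin m, ContDiffOn ℝ (⊤ : ℕ∞) (fun x => Ψ x i j) U)
    (hclosed1 : ∀ x ∈ U, ∀ i j k : Fin m,
      pd k (fun y => Ψ y i j) x = pd j (fun y => Ψ y i k) x)
    (hclosed2 : ∀ x ∈ U, ∀ i j k : Fin m,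
      pd k (fun y => Ψ y j i) x = pd j (fun y => Ψ y k i) x) :
    ∃ (τ : (Fin m → ℝ) → ℝ) (C : Matrix (Fin m) (Fin m) ℝ),
      ContDiffOn ℝ (⊤ : ℕ∞) τ U ∧ Cᵀ = -C ∧
      (∀ x ∈ U, ∀ i j : Fin m, Ψ x i j = pd i (fun y => pd j τ y) x + C i j) ∧
      ((∀ x ∈ U, ∀ v : Fin m → ℝ, v ≠ 0 → 0 < v ⬝ᵥ (Ψ x) *ᵥ v) →
        ∀ x ∈ U, ∀ v : Fin m → ℝ, v ≠ 0 →
          0 < v ⬝ᵥ (Matrix.of fun i j => pd i (fun y => pd j τ y) x) *ᵥ v) := by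
  rcases U.eq_empty_or_nonempty with rfl | ⟨x0, hx0⟩
  · exact ⟨0, 0, by simp, by simp, by simp, by simp⟩
  have hd : ∀ i j, ∀ a ∈ U, DifferentiableAt ℝ (fun x => Ψ x i j) a := fun i j a ha =>
    ((hsmooth i j).contDiffAt (hU.mem_nhds ha)).differentiableAt (by simp)
  have hsym : ∀ x ∈ U, ∀ i j k : Fin m,
      pd k (fun y => Ψ y i j) x = pd k (fun y => Ψ y j i) x := by
    intro x hx i j k
    rw [hclosed1 x hx i j k, hclosed2 x hx k i j, hclosed1 x hx j k i]
  have hconst : ∀ x ∈ U, ∀ i j, Ψ x i j - Ψ x j i = Ψ x0 i j - Ψ x0 j i := by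
    intro x hx i j
    refine hconv.is_const_of_fderivWithin_eq_zero (𝕜 := ℝ)
      (f := fun x => Ψ x i j - Ψ x j i) (fun a ha =>
        ((hd i j a ha).sub (hd j i a ha)).differentiableWithinAt) ?_ hx hx0
    intro a ha
    rw [fderivWithin_of_isOpen hU ha, fderiv_fun_sub (hd i j a ha) (hd j i a ha), sub_eq_zero]
    ext v
    simp only [fderiv_eq_sum_pd, hsym a ha i j]
  let C : Matrix (Fin m) (Fin m) ℝ := Matrix.of fun i j => (Ψ x0 i j - Ψ x0 j i) / 2
  have hC : Cᵀ = -C := by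
    ext i j; simp [C]; ring
  have hpdC : ∀ x i j k, pd k (fun y => Ψ y i j - C i j) x = pd k (fun y => Ψ y i j) x := by
    intro x i j k
    rw [pd, pd, fderiv_sub_const]
  have h1 : ∀ j, ∃ f : (Fin m → ℝ) → ℝ, ContDiffOn ℝ (⊤ : ℕ∞) f U ∧
      ∀ x ∈ U, ∀ i, pd i f x = Ψ x i j - C i j := fun j =>
    poinc U hU hconv (fun i x => Ψ x i j - C i j)
      (fun i => (hsmooth i j).sub contDiffOn_const) (by
        intro x hx i k
        simp only [hpdC]
        exact hclosed2 x hx j i k)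
  choose φ hφ hφd using h1
  obtain ⟨τ, hτ, hτd⟩ := poinc U hU hconv φ hφ (by
    intro x hx j k
    rw [hφd j x hx k, hφd k x hx j]
    have := hconst x hx j k
    simp only [C, Matrix.of_apply]
    linarith)
  have key : ∀ x ∈ U, ∀ i j : Fin m, Ψ x i j = pd i (fun y => pd j τ y) x + C i j := by
    intro x hx i j
    rw [pd_congr_open hU (fun y hy => hτd y hy j) x hx i]
    change _ = pd i (φ j) x + _
    rw [hφd j x hx i]; ring
  refine ⟨τ, C, hτ, hC, key, ?_⟩
  intro hpos x hx v hv
  have h := hpos x hx v hv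
  have e : Ψ x = (Matrix.of fun i j => pd i (fun y => pd j τ y) x) + C := by
    ext i j; exact key x hx i j
  rwa [e, Matrix.add_mulVec, dotProduct_add, antisymm_quad C hC, add_zero] at h
end
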